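/- Let γ ∈ [0,1], p = 1, k > 0, m(v) = ⟨v⟩^k, and θ ∈ ℝ arbitrary. Then δ₁(1,θ) = 1 and δ₂(1,θ) = 0, so that φ_{m,1,θ}(v) = 2k J_{γ+2}(v) ⟨v⟩^{−2} + k(k−2) ℓ₁(v) |v|² ⟨v⟩^{−4} − 2k ℓ₁(v) |v|² ⟨v⟩^{−2}, and limsup_{|v|→∞} φ_{m,1,θ}(v) ⟨v⟩^{−γ} ≤ −2k. -/

import Mathlib

open MeasureTheory Real Filter

noncomputable section

abbrev E3 : Type := EuclideanSpace ℝ (Fin 3)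

/-- The standard Gaussian on ℝ³. -/
def gauss (v : E3) : ℝ :=
  (2 * π) ^ (-(3 : ℝ) / 2) * Real.exp (-‖v‖ ^ 2 / 2)

/-- `J_α(v) = ∫ |v - w|^α μ(w) dw`. -/
def Jfun (α : ℝ) (v : E3) : ℝ :=
  ∫ w : E3, ‖v - w‖ ^ α * gauss w

/-- The matrix `a_{ij}(z) = |z|^{γ+2} (δ_{ij} - z_i z_j / |z|²)` (equal to `0` at `z = 0`). -/
def amat (γ : ℝ) (z : E3) (i j : Fin 3) : ℝ :=
  ‖z‖ ^ (γ + 2) * ((if i = j then (1 : ℝ) else 0) - z i * z j / ‖z‖ ^ 2)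

/-- The entrywise convolution `ā = a * μ`. -/
def abar (γ : ℝ) (v : E3) (i j : Fin 3) : ℝ :=
  ∫ w : E3, amat γ (v - w) i j * gauss w

/-- The eigenvalue `ℓ₁(v)` of `ā(v)` in the direction `v`. -/
def ell1 (γ : ℝ) (v : E3) : ℝ :=
  ∫ w : E3, (1 - (∑ i, (v i / ‖v‖) * (w i / ‖w‖)) ^ 2) * ‖w‖ ^ (γ + 2) * gauss (v - w)

/-- Squared norm of the cross product of two vectors of ℝ³. -/
def crossSq (u w : Fin 3 → ℝ) : ℝ :=
  (u 1 * w 2 - u 2 * w 1) ^ 2 + (u 2 * w 0 - u 0 * w 2) ^ 2 + (u 0 * w 1 - u 1 * w 0) ^ 2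

/-- The eigenvalue `ℓ₂(v)` of `ā(v)` on `v^⊥`. -/
def ell2 (γ : ℝ) (v : E3) : ℝ :=
  ∫ w : E3, (1 - (1 / 2) * crossSq (fun i => v i / ‖v‖) (fun i => w i / ‖w‖)) *
    ‖w‖ ^ (γ + 2) * gauss (v - w)
/-- The partial derivative `∂_i f` in the `i`-th coordinate direction. -/
def pd (i : Fin 3) (f : E3 → ℝ) : E3 → ℝ :=
  fun v => fderiv ℝ f v (EuclideanSpace.single i 1)

/-- The weight `⟨v⟩ = (1 + |v|²)^{1/2}`. -/
def jap (v : E3) : ℝ := Real.sqrt (1 + ‖v‖ ^ 2)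

/-- `c(z) = -2 (γ+3) |z|^γ`. -/
def cfun (γ : ℝ) (z : E3) : ℝ := -2 * (γ + 3) * ‖z‖ ^ γ

/-- `b(z) = -2 |z|^γ z`. -/
def bvec (γ : ℝ) (z : E3) (i : Fin 3) : ℝ := -2 * ‖z‖ ^ γ * z i

/-- The convolution `b̄ = b * μ`. -/
def bbar (γ : ℝ) (v : E3) (i : Fin 3) : ℝ :=
  ∫ w : E3, bvec γ (v - w) i * gauss w

/-- The convolution `c̄ = c * μ`. -/
def cbar (γ : ℝ) (v : E3) : ℝ := ∫ w : E3, cfun γ (v - w) * gauss w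

def delta1 (p θ : ℝ) : ℝ := 1 - 2 * θ * (1 - 1 / p)

def delta2 (p θ : ℝ) : ℝ := delta1 p θ * (p * (1 - θ) - 1) + θ * (p - θ * (p - 1))

/-- The function `φ_{m,p,θ}`. -/
def phiW (γ p θ : ℝ) (m : E3 → ℝ) (v : E3) : ℝ :=
  delta1 p θ * (∑ i, ∑ j, abar γ v i j * pd i (pd j m) v / m v) +
  delta2 p θ * (∑ i, ∑ j, abar γ v i j * (pd i m v / m v) * (pd j m v / m v)) +
  (1 + delta1 p θ) * (∑ i, bbar γ v i * pd i m v / m v) +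
  (1 / p - 1) * cbar γ v

/-! ### Integrability against the Gaussian -/

lemma gauss_nonneg (w : E3) : 0 ≤ gauss w := by unfold gauss; positivity

lemma gauss_cont : Continuous gauss := by unfold gauss; fun_prop

lemma integrable_exp_quarter : Integrable (fun w : E3 => Real.exp (-(1/4) * ‖w‖ ^ 2)) := by
  have h := GaussianFourier.integral_rexp_neg_mul_sq_norm (V := E3) (b := 1/4) (by norm_num)
  by_contra hc
  rw [integral_undef hc] at h
  have : 0 < (π / (1/4)) ^ ((Module.finrank ℝ E3 : ℝ) / 2) := by positivity
  linarith

lemma integral_gauss : ∫ w : E3, gauss w = 1 := by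
  have h := GaussianFourier.integral_rexp_neg_mul_sq_norm (V := E3) (b := 1/2) (by norm_num)
  have h2 : ∀ w : E3, gauss w = (2 * π) ^ (-(3 : ℝ) / 2) * Real.exp (-(1/2) * ‖w‖ ^ 2) := by
    intro w; unfold gauss; congr 2; ring
  simp_rw [h2]
  rw [integral_const_mul, h]
  simp only [finrank_euclideanSpace, Fintype.card_fin]
  rw [show π / (1/2) = 2 * π by ring, ← Real.rpow_add (by positivity)]
  norm_num

lemma poly_gauss_bound (N : ℕ) : ∃ C : ℝ, ∀ w : E3,
    (1 + ‖w‖) ^ N * gauss w ≤ C * Real.exp (-(1/4) * ‖w‖ ^ 2) := by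
  have ht : Tendsto (fun x : ℝ => x ^ N * Real.exp (-x)) atTop (nhds 0) :=
    Real.tendsto_pow_mul_exp_neg_atTop_nhds_zero N
  obtain ⟨C, hC⟩ : ∃ C : ℝ, ∀ x : ℝ, 0 ≤ x → (1 + x) ^ N * Real.exp (-(1 + x)) ≤ C := by
    have h1 : ∀ᶠ x in atTop, x ^ N * Real.exp (-x) < 1 := ht.eventually_lt_const one_pos
    obtain ⟨A, hA⟩ := eventually_atTop.1 h1
    refine ⟨1 + (1 + |A|) ^ N, fun x hx => ?_⟩
    by_cases hxA : A ≤ 1 + x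
    · have := hA _ hxA
      have : 0 ≤ (1 + |A|) ^ N := by positivity
      linarith [hA _ hxA]
    · have h2 : (1 + x) ^ N ≤ (1 + |A|) ^ N := by
        apply pow_le_pow_left₀ (by linarith)
        have := le_abs_self A
        linarith
      have h3 : Real.exp (-(1 + x)) ≤ 1 := Real.exp_le_one_iff.2 (by linarith)
      have : (1 + x) ^ N * Real.exp (-(1 + x)) ≤ (1 + |A|) ^ N * 1 :=
        mul_le_mul h2 h3 (Real.exp_pos _).le (by positivity)
      linarith
  refine ⟨C * (Real.exp 2 * (2 * π) ^ (-(3 : ℝ) / 2)), fun w => ?_⟩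
  have h := hC ‖w‖ (norm_nonneg _)
  have h4 : Real.exp (-‖w‖ ^ 2 / 2) ≤
      Real.exp (-(1 + ‖w‖)) * (Real.exp 2 * Real.exp (-(1/4) * ‖w‖ ^ 2)) := by
    rw [← Real.exp_add, ← Real.exp_add]
    apply Real.exp_le_exp.2
    nlinarith [sq_nonneg (‖w‖ - 2)]
  unfold gauss
  have hc : 0 < (2 * π) ^ (-(3 : ℝ) / 2) := by positivity
  calc (1 + ‖w‖) ^ N * ((2 * π) ^ (-(3 : ℝ) / 2) * Real.exp (-‖w‖ ^ 2 / 2))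
      ≤ (1 + ‖w‖) ^ N * ((2 * π) ^ (-(3 : ℝ) / 2) *
        (Real.exp (-(1 + ‖w‖)) * (Real.exp 2 * Real.exp (-(1/4) * ‖w‖ ^ 2)))) := by gcongr
    _ = ((1 + ‖w‖) ^ N * Real.exp (-(1 + ‖w‖))) *
        (Real.exp 2 * (2 * π) ^ (-(3 : ℝ) / 2) * Real.exp (-(1/4) * ‖w‖ ^ 2)) := by ring
    _ ≤ C * (Real.exp 2 * (2 * π) ^ (-(3 : ℝ) / 2) * Real.exp (-(1/4) * ‖w‖ ^ 2)) := by gcongr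
    _ = _ := by ring

lemma integrable_poly_gauss (N : ℕ) : Integrable (fun w : E3 => (1 + ‖w‖) ^ N * gauss w) := by
  obtain ⟨C, hC⟩ := poly_gauss_bound N
  refine (integrable_exp_quarter.const_mul C).mono' ?_ (ae_of_all _ fun w => ?_)
  · exact (Continuous.mul (by fun_prop) gauss_cont).aestronglyMeasurable
  · rw [Real.norm_of_nonneg (mul_nonneg (by positivity) (gauss_nonneg w))]
    exact hC w

/-- Continuous functions of polynomial growth are integrable against the shifted Gaussian. -/
lemma integrable_growth {F : E3 → ℝ} (hF : Measurable F) (C : ℝ) (N : ℕ)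
    (hb : ∀ z, |F z| ≤ C * (1 + ‖z‖) ^ N) (v : E3) :
    Integrable (fun w : E3 => F (v - w) * gauss w) := by
  have hC : 0 ≤ C := by
    have := hb 0
    simp at this
    exact (abs_nonneg _).trans this
  refine ((integrable_poly_gauss N).const_mul (C * (1 + ‖v‖) ^ N)).mono' ?_
    (ae_of_all _ fun w => ?_)
  · exact ((hF.comp (measurable_const.sub measurable_id)).mul
      gauss_cont.measurable).aestronglyMeasurable
  · rw [norm_mul, Real.norm_of_nonneg (gauss_nonneg w), Real.norm_eq_abs, ← mul_assoc, mul_assoc C,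
      ← mul_pow]
    gcongr
    · exact gauss_nonneg w
    refine (hb _).trans ?_
    gcongr
    have := norm_sub_le v w
    nlinarith [norm_nonneg v, norm_nonneg w]

lemma integrable_growth_left {F : E3 → ℝ} (hF : Measurable F) (C : ℝ) (N : ℕ)
    (hb : ∀ z, |F z| ≤ C * (1 + ‖z‖) ^ N) (v : E3) :
    Integrable (fun z : E3 => F z * gauss (v - z)) := by
  have := (integrable_growth hF C N hb v).comp_sub_left v
  simpa using this

/-! ### The derivative of the coefficients -/

lemma coord_le (z : E3) (j : Fin 3) : |z j| ≤ ‖z‖ := by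
  simpa using PiLp.norm_apply_le z j

lemma inner_coord (v z : E3) : inner ℝ v z = ∑ i, v i * z i := by
  simp [PiLp.inner_apply, mul_comm]

lemma normsq_hasFDerivAt (z : E3) :
    HasFDerivAt (fun z : E3 => ‖z‖ ^ 2) ((2 : ℝ) • innerSL ℝ z) z := by
  have h := (hasStrictFDerivAt_norm_sq z).hasFDerivAt
  have e : ((2 : ℝ) • innerSL ℝ z : E3 →L[ℝ] ℝ) = (2 : ℕ) • innerSL ℝ z := by
    ext w; simp
  rw [e]
  exact h

/-- The quadratic part of the `j`-th coordinate of `a(z) v`. -/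
def qf (v : E3) (j : Fin 3) (z : E3) : ℝ := ‖z‖ ^ 2 * v j - inner ℝ v z * z j

def qf' (v : E3) (j : Fin 3) (z : E3) : E3 →L[ℝ] ℝ :=
  v j • ((2 : ℝ) • innerSL ℝ z) -
    ((inner ℝ v z) • (EuclideanSpace.proj j : E3 →L[ℝ] ℝ) + z j • innerSL ℝ v)

lemma qf_hasFDerivAt (v : E3) (j : Fin 3) (z : E3) : HasFDerivAt (qf v j) (qf' v j z) z := by
  have h1 := normsq_hasFDerivAt z
  have h2 : HasFDerivAt (fun z : E3 => inner ℝ v z) (innerSL ℝ v) z :=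
    (innerSL ℝ v).hasFDerivAt
  have h3 : HasFDerivAt (fun z : E3 => z j) (EuclideanSpace.proj j : E3 →L[ℝ] ℝ) z :=
    (EuclideanSpace.proj j : E3 →L[ℝ] ℝ).hasFDerivAt
  exact (h1.mul_const (v j)).sub (h2.mul h3)

lemma qf_bound (v : E3) (j : Fin 3) (z : E3) : |qf v j z| ≤ 2 * ‖v‖ * ‖z‖ ^ 2 := by
  unfold qf
  have h1 : |‖z‖ ^ 2 * v j| ≤ ‖z‖ ^ 2 * ‖v‖ := by
    rw [abs_mul, abs_of_nonneg (sq_nonneg ‖z‖)]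
    gcongr
    exact coord_le v j
  have h2 : |inner ℝ v z * z j| ≤ (‖v‖ * ‖z‖) * ‖z‖ := by
    rw [abs_mul]
    exact mul_le_mul (abs_real_inner_le_norm v z) (coord_le z j) (abs_nonneg _) (by positivity)
  have := abs_sub (‖z‖ ^ 2 * v j) (inner ℝ v z * z j)
  nlinarith

lemma rpow_cont (γ : ℝ) (hγ0 : 0 ≤ γ) : Continuous (fun z : E3 => ‖z‖ ^ γ) :=
  continuous_norm.rpow_const fun _ => Or.inr hγ0

lemma rpow_bound (γ : ℝ) (hγ0 : 0 ≤ γ) (hγ1 : γ ≤ 1) (z : E3) : ‖z‖ ^ γ ≤ 1 + ‖z‖ := by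
  calc ‖z‖ ^ γ ≤ (1 + ‖z‖) ^ γ := by gcongr; linarith
    _ ≤ (1 + ‖z‖) ^ (1 : ℝ) := Real.rpow_le_rpow_of_exponent_le (by linarith [norm_nonneg z]) hγ1
    _ = _ := Real.rpow_one _

/-- The `j`-th coordinate of `a(z) v`. -/
def fcoef (γ : ℝ) (v : E3) (j : Fin 3) (z : E3) : ℝ := ‖z‖ ^ γ * qf v j z

def fcoef' (γ : ℝ) (v : E3) (j : Fin 3) (z : E3) : E3 →L[ℝ] ℝ :=
  ‖z‖ ^ γ • qf' v j z + qf v j z • ((γ * ‖z‖ ^ (γ - 2)) • innerSL ℝ z)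

lemma fcoef_hasFDerivAt (γ : ℝ) (hγ0 : 0 ≤ γ) (hγ1 : γ ≤ 1) (v : E3) (j : Fin 3) (z : E3) :
    HasFDerivAt (fcoef γ v j) (fcoef' γ v j z) z := by
  by_cases hz : z = 0
  · subst hz
    have h0 : fcoef' γ v j 0 = 0 := by
      ext w; simp [fcoef', qf', qf]
    rw [h0]
    have hO : (fcoef γ v j) =O[nhds 0] fun x => ‖x - 0‖ ^ 2 := by
      refine Asymptotics.IsBigO.of_bound (2 * ‖v‖ * 2) ?_
      filter_upwards [Metric.ball_mem_nhds (0 : E3) one_pos] with x hx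
      have hx1 : ‖x‖ < 1 := by simpa using hx
      have h1 := rpow_bound γ hγ0 hγ1 x
      have h2 := qf_bound v j x
      simp only [fcoef, sub_zero, norm_pow, norm_norm]
      rw [norm_mul, Real.norm_of_nonneg (by positivity), Real.norm_eq_abs]
      calc ‖x‖ ^ γ * |qf v j x| ≤ 2 * (2 * ‖v‖ * ‖x‖ ^ 2) := by
            apply mul_le_mul (by linarith) h2 (abs_nonneg _) (by norm_num)
        _ = _ := by ring
    exact hO.hasFDerivAt (by norm_num)
  · have hn : 0 < ‖z‖ := norm_pos_iff.2 hz
    have h1 := normsq_hasFDerivAt z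
    have h2 := h1.rpow_const (p := γ / 2) (Or.inl (by positivity))
    have h3 : HasFDerivAt (fun z : E3 => ‖z‖ ^ γ) ((γ * ‖z‖ ^ (γ - 2)) • innerSL ℝ z) z := by
      have e1 : (fun z : E3 => ‖z‖ ^ γ) = fun z : E3 => (‖z‖ ^ 2) ^ (γ / 2) := by
        funext x
        rw [← Real.rpow_natCast, ← Real.rpow_mul (norm_nonneg _)]
        congr 1; push_cast; ring
      rw [e1]
      have e2 : ((γ * ‖z‖ ^ (γ - 2)) • innerSL ℝ z : E3 →L[ℝ] ℝ) =
          (γ / 2 * (‖z‖ ^ 2) ^ (γ / 2 - 1)) • (2 : ℝ) • innerSL ℝ z := by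
        rw [smul_smul]
        congr 1
        rw [← Real.rpow_natCast, ← Real.rpow_mul (norm_nonneg _)]
        rw [show ((2 : ℕ) : ℝ) * (γ / 2 - 1) = γ - 2 by push_cast; ring]
        ring
      rw [e2]
      exact h2
    exact h3.mul (qf_hasFDerivAt v j z)

lemma fcoef_cont (γ : ℝ) (hγ0 : 0 ≤ γ) (v : E3) (j : Fin 3) : Continuous (fcoef γ v j) := by
  have := rpow_cont γ hγ0
  unfold fcoef qf
  fun_prop

lemma fcoef_bound (γ : ℝ) (hγ0 : 0 ≤ γ) (hγ1 : γ ≤ 1) (v : E3) (j : Fin 3) (z : E3) :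
    |fcoef γ v j z| ≤ (2 * ‖v‖) * (1 + ‖z‖) ^ 3 := by
  have h1 := rpow_bound γ hγ0 hγ1 z
  have h2 := qf_bound v j z
  unfold fcoef
  rw [abs_mul, abs_of_nonneg (by positivity : 0 ≤ ‖z‖ ^ γ)]
  calc ‖z‖ ^ γ * |qf v j z| ≤ (1 + ‖z‖) * (2 * ‖v‖ * ‖z‖ ^ 2) := by gcongr
    _ ≤ (1 + ‖z‖) * (2 * ‖v‖ * (1 + ‖z‖) ^ 2) := by gcongr; linarith
    _ = _ := by ring

/-! ### Integration by parts -/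

lemma single_inner (z : E3) (j : Fin 3) : inner ℝ z (EuclideanSpace.single j (1 : ℝ)) = z j := by
  simp [EuclideanSpace.inner_single_right]

lemma fcoef'_single (γ : ℝ) (v : E3) (j : Fin 3) (z : E3) :
    fcoef' γ v j z (EuclideanSpace.single j 1) =
      ‖z‖ ^ γ * (v j * z j - inner ℝ v z) + qf v j z * (γ * ‖z‖ ^ (γ - 2) * z j) := by
  simp [fcoef', qf', single_inner]
  left
  ring

lemma qf_orth (v z : E3) : ∑ j, qf v j z * z j = 0 := by
  have h1 : ‖z‖ ^ 2 = ∑ i, z i * z i := by rw [← inner_coord, real_inner_self_eq_norm_sq]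
  simp only [qf, h1, inner_coord, Fin.sum_univ_three]
  ring

lemma div_fcoef (γ : ℝ) (v z : E3) :
    ∑ j, fcoef' γ v j z (EuclideanSpace.single j 1) = -2 * (‖z‖ ^ γ * inner ℝ v z) := by
  have h := qf_orth v z
  simp only [fcoef'_single]
  rw [Finset.sum_add_distrib]
  have e : ∑ j, qf v j z * (γ * ‖z‖ ^ (γ - 2) * z j) = γ * ‖z‖ ^ (γ - 2) * ∑ j, qf v j z * z j := by
    rw [Finset.mul_sum]; exact Finset.sum_congr rfl fun j _ => by ring
  rw [e, h]
  simp only [inner_coord, Fin.sum_univ_three]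
  ring

lemma gauss_hasFDerivAt (v z : E3) :
    HasFDerivAt (fun z : E3 => gauss (v - z)) (gauss (v - z) • innerSL ℝ (v - z)) z := by
  have h1 := (normsq_hasFDerivAt (v - z)).comp z ((hasFDerivAt_id z).const_sub v)
  have h2 := ((h1.const_mul (-1 / 2 : ℝ)).exp).const_mul ((2 * π) ^ (-(3 : ℝ) / 2))
  have e : (fun z : E3 => gauss (v - z)) = fun z : E3 => (2 * π) ^ (-(3 : ℝ) / 2) *
      Real.exp (-1 / 2 * ((fun z : E3 => ‖z‖ ^ 2) ∘ fun x => v - id x) z) := by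
    funext x
    simp only [gauss, Function.comp, id]
    congr 2; ring
  rw [e]
  refine h2.congr_fderiv ?_
  ext w
  simp [gauss]
  rw [show -1 / 2 * ‖v - z‖ ^ 2 = -‖v - z‖ ^ 2 / 2 by ring]
  ring

lemma fcoef'_meas (γ : ℝ) (hγ0 : 0 ≤ γ) (v : E3) (j : Fin 3) :
    Measurable (fun z => fcoef' γ v j z (EuclideanSpace.single j 1)) := by
  simp only [fcoef'_single]
  have h1 : Measurable fun z : E3 => ‖z‖ := measurable_norm
  have h2 : Measurable fun z : E3 => z j := by fun_prop
  have h3 : Measurable fun z : E3 => (inner ℝ v z : ℝ) := by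
    apply Continuous.measurable; fun_prop
  have h4 : Measurable (qf v j) := by
    apply Continuous.measurable; unfold qf; fun_prop
  exact ((h1.pow_const γ).mul ((measurable_const.mul h2).sub h3)).add
    (h4.mul ((measurable_const.mul (h1.pow_const (γ - 2))).mul h2))

lemma fcoef'_bound (γ : ℝ) (hγ0 : 0 ≤ γ) (hγ1 : γ ≤ 1) (v : E3) (j : Fin 3) (z : E3) :
    |fcoef' γ v j z (EuclideanSpace.single j 1)| ≤ (4 * ‖v‖) * (1 + ‖z‖) ^ 2 := by
  rw [fcoef'_single]
  have hn := norm_nonneg z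
  have hv := norm_nonneg v
  have h1 := rpow_bound γ hγ0 hγ1 z
  have h2 := qf_bound v j z
  have h3 : |v j * z j - inner ℝ v z| ≤ 2 * ‖v‖ * ‖z‖ := by
    have a1 : |v j * z j| ≤ ‖v‖ * ‖z‖ := by
      rw [abs_mul]; exact mul_le_mul (coord_le v j) (coord_le z j) (abs_nonneg _) hv
    have := abs_sub (v j * z j) (inner ℝ v z)
    have := abs_real_inner_le_norm v z
    linarith
  have h4 : |‖z‖ ^ γ * (v j * z j - inner ℝ v z)| ≤ (1 + ‖z‖) * (2 * ‖v‖ * ‖z‖) := by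
    rw [abs_mul, abs_of_nonneg (by positivity : 0 ≤ ‖z‖ ^ γ)]
    gcongr
  have h5 : ‖z‖ ^ (γ - 2) * ‖z‖ ^ 2 ≤ ‖z‖ ^ γ := by
    by_cases hz : ‖z‖ = 0
    · rw [hz]; simp; positivity
    · have : 0 < ‖z‖ := lt_of_le_of_ne hn (Ne.symm hz)
      rw [← Real.rpow_natCast, ← Real.rpow_add this]
      norm_num
  have h6 : |qf v j z * (γ * ‖z‖ ^ (γ - 2) * z j)| ≤ 2 * ‖v‖ * ((1 + ‖z‖) * ‖z‖) := by
    rw [abs_mul, abs_mul, abs_mul, abs_of_nonneg hγ0,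
      abs_of_nonneg (by positivity : 0 ≤ ‖z‖ ^ (γ - 2))]
    calc |qf v j z| * (γ * ‖z‖ ^ (γ - 2) * |z j|)
        ≤ (2 * ‖v‖ * ‖z‖ ^ 2) * (1 * ‖z‖ ^ (γ - 2) * ‖z‖) := by
          gcongr
          exact coord_le z j
      _ = 2 * ‖v‖ * ((‖z‖ ^ (γ - 2) * ‖z‖ ^ 2) * ‖z‖) := by ring
      _ ≤ 2 * ‖v‖ * ((1 + ‖z‖) * ‖z‖) := by
          gcongr
          linarith
  refine (abs_add_le _ _).trans ?_
  nlinarith [mul_nonneg hv hn]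

lemma fcoef_shift_integrable (γ : ℝ) (hγ0 : 0 ≤ γ) (hγ1 : γ ≤ 1) (v : E3) (j : Fin 3) :
    Integrable fun z : E3 => fcoef γ v j z * (v j - z j) * gauss (v - z) := by
  have hc := fcoef_cont γ hγ0 v j
  refine integrable_growth_left (F := fun z => fcoef γ v j z * (v j - z j))
    (Continuous.measurable (by fun_prop)) (2 * ‖v‖ * (1 + ‖v‖)) 4 (fun z => ?_) v
  rw [abs_mul]
  have h1 := fcoef_bound γ hγ0 hγ1 v j z
  have h2 : |v j - z j| ≤ (1 + ‖v‖) * (1 + ‖z‖) := by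
    have := abs_sub (v j) (z j)
    have := coord_le v j
    have := coord_le z j
    nlinarith [norm_nonneg v, norm_nonneg z]
  calc _ ≤ (2 * ‖v‖) * (1 + ‖z‖) ^ 3 * ((1 + ‖v‖) * (1 + ‖z‖)) := by gcongr
    _ = _ := by ring

lemma ibp (γ : ℝ) (hγ0 : 0 ≤ γ) (hγ1 : γ ≤ 1) (v : E3) (j : Fin 3) :
    ∫ z : E3, fcoef γ v j z * (v j - z j) * gauss (v - z) =
      - ∫ z : E3, fcoef' γ v j z (EuclideanSpace.single j 1) * gauss (v - z) := by
  have i1 := integrable_growth_left (fcoef'_meas γ hγ0 v j) _ _ (fcoef'_bound γ hγ0 hγ1 v j) v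
  have i2 := fcoef_shift_integrable γ hγ0 hγ1 v j
  have i3 := integrable_growth_left (fcoef_cont γ hγ0 v j).measurable _ _
    (fcoef_bound γ hγ0 hγ1 v j) v
  have e : ∀ z : E3, fcoef γ v j z * (v j - z j) * gauss (v - z) =
      ContinuousLinearMap.mul ℝ ℝ (fcoef γ v j z)
        ((gauss (v - z) • innerSL ℝ (v - z)) (EuclideanSpace.single j 1)) := by
    intro z
    simp only [ContinuousLinearMap.mul_apply', smul_apply, innerSL_apply_apply,
      single_inner, PiLp.sub_apply, smul_eq_mul]
    ring
  simp_rw [e] at i2 ⊢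
  exact integral_bilinear_hasFDerivAt_right_eq_neg_left_of_integrable
    (B := ContinuousLinearMap.mul ℝ ℝ) (f := fcoef γ v j) (f' := fcoef' γ v j)
    (g := fun z => gauss (v - z)) (g' := fun z => gauss (v - z) • innerSL ℝ (v - z))
    i1 i2 i3 (fun z _ => fcoef_hasFDerivAt γ hγ0 hγ1 v j z) (fun z _ => gauss_hasFDerivAt v z)

/-- `ā(v) v · v`. -/
def Tf (γ : ℝ) (v : E3) : ℝ := ∫ w : E3, (∑ j, fcoef γ v j (v - w) * v j) * gauss w

lemma Tf_eq (γ : ℝ) (hγ0 : 0 ≤ γ) (hγ1 : γ ≤ 1) (v : E3) :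
    Tf γ v = 2 * ∫ w : E3, (‖v - w‖ ^ γ * inner ℝ v (v - w)) * gauss w := by
  have s1 : Tf γ v = ∫ z : E3, (∑ j, fcoef γ v j z * v j) * gauss (v - z) := by
    unfold Tf
    rw [← integral_sub_left_eq_self (fun w : E3 => (∑ j, fcoef γ v j (v - w) * v j) * gauss w)
      volume v]
    simp
  have s2 : ∫ w : E3, (‖v - w‖ ^ γ * inner ℝ v (v - w)) * gauss w =
      ∫ z : E3, (‖z‖ ^ γ * inner ℝ v z) * gauss (v - z) := by
    rw [← integral_sub_left_eq_self
      (fun w : E3 => (‖v - w‖ ^ γ * inner ℝ v (v - w)) * gauss w) volume v]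
    simp
  have s3 : ∀ z : E3, (∑ j, fcoef γ v j z * v j) * gauss (v - z) =
      ∑ j, fcoef γ v j z * (v j - z j) * gauss (v - z) := by
    intro z
    have h := qf_orth v z
    have h' : ∑ j, fcoef γ v j z * z j = 0 := by
      simp only [fcoef, mul_assoc]; rw [← Finset.mul_sum, h, mul_zero]
    rw [← Finset.sum_mul]
    simp only [mul_sub]
    rw [Finset.sum_sub_distrib, h', sub_zero]
  rw [s1, s2]
  simp_rw [s3]
  rw [integral_finsetSum _ fun j _ => fcoef_shift_integrable γ hγ0 hγ1 v j]
  simp_rw [ibp γ hγ0 hγ1 v]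
  rw [Finset.sum_neg_distrib, ← integral_finsetSum _ fun j _ =>
    integrable_growth_left (fcoef'_meas γ hγ0 v j) _ _ (fcoef'_bound γ hγ0 hγ1 v j) v]
  simp_rw [← Finset.sum_mul, div_fcoef]
  rw [← integral_neg, ← integral_const_mul]
  congr 1; funext z; ring

/-! ### The coefficients in terms of `Tf` -/

lemma amat_eq (γ : ℝ) (hγ0 : 0 ≤ γ) (z : E3) (i j : Fin 3) :
    amat γ z i j = fcoef γ (EuclideanSpace.single i 1) j z := by
  have hin : inner ℝ (EuclideanSpace.single i (1 : ℝ)) z = z i := by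
    rw [real_inner_comm, single_inner]
  have hs : (EuclideanSpace.single i (1 : ℝ) : E3) j = if i = j then 1 else 0 := by
    simp [Pi.single_apply, eq_comm]
  unfold amat fcoef qf
  rw [hin, hs]
  by_cases hz : z = 0
  · subst hz
    simp [Real.zero_rpow (by linarith : γ + 2 ≠ 0)]
  · have hn : 0 < ‖z‖ := norm_pos_iff.2 hz
    rw [Real.rpow_add hn, Real.rpow_two]
    field_simp

lemma fcoef_lin (γ : ℝ) (v : E3) (j : Fin 3) (z : E3) :
    ∑ i, v i * fcoef γ (EuclideanSpace.single i 1) j z = fcoef γ v j z := by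
  have hin : ∀ i, inner ℝ (EuclideanSpace.single i (1 : ℝ)) z = z i := by
    intro i; rw [real_inner_comm, single_inner]
  have hs : ∀ i, (EuclideanSpace.single i (1 : ℝ) : E3) j = if i = j then 1 else 0 := by
    intro i; simp [Pi.single_apply, eq_comm]
  simp only [fcoef, qf, hin, hs, inner_coord]
  fin_cases j <;> simp [Fin.sum_univ_three] <;> ring

lemma amat_integrable (γ : ℝ) (hγ0 : 0 ≤ γ) (hγ1 : γ ≤ 1) (v : E3) (i j : Fin 3) :
    Integrable fun w : E3 => amat γ (v - w) i j * gauss w := by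
  simp_rw [amat_eq γ hγ0]
  exact integrable_growth (fcoef_cont γ hγ0 _ j).measurable _ _ (fcoef_bound γ hγ0 hγ1 _ j) v

lemma abar_quad (γ : ℝ) (hγ0 : 0 ≤ γ) (hγ1 : γ ≤ 1) (v : E3) :
    ∑ i, ∑ j, abar γ v i j * (v i * v j) = Tf γ v := by
  unfold abar Tf
  simp_rw [← integral_mul_const]
  rw [Finset.sum_congr rfl fun i _ => (integral_finsetSum Finset.univ fun j _ =>
    (amat_integrable γ hγ0 hγ1 v i j).mul_const (v i * v j)).symm]
  rw [← integral_finsetSum _ fun i _ => integrable_finsetSum _ fun j _ =>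
    (amat_integrable γ hγ0 hγ1 v i j).mul_const (v i * v j)]
  congr 1; funext w
  rw [Finset.sum_comm, Finset.sum_mul]
  refine Finset.sum_congr rfl fun j _ => ?_
  rw [← fcoef_lin, Finset.sum_mul, Finset.sum_mul]
  refine Finset.sum_congr rfl fun i _ => ?_
  rw [amat_eq γ hγ0]; ring

lemma abar_trace (γ : ℝ) (hγ0 : 0 ≤ γ) (hγ1 : γ ≤ 1) (v : E3) :
    ∑ i, abar γ v i i = 2 * Jfun (γ + 2) v := by
  unfold abar Jfun
  rw [← integral_finsetSum _ fun i _ => amat_integrable γ hγ0 hγ1 v i i, ← integral_const_mul]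
  congr 1; funext w
  rw [← Finset.sum_mul, ← mul_assoc]
  congr 1
  generalize v - w = z
  by_cases hz : z = 0
  · subst hz
    simp [amat, Real.zero_rpow (by linarith : γ + 2 ≠ 0)]
  · have hn : 0 < ‖z‖ := norm_pos_iff.2 hz
    have h1 : ‖z‖ ^ 2 = ∑ i, z i * z i := by rw [← inner_coord, real_inner_self_eq_norm_sq]
    have h2 : ∑ i, z i * z i / ‖z‖ ^ 2 = 1 := by
      rw [← Finset.sum_div, ← h1, div_self (by positivity)]
    simp only [amat, if_true]
    rw [← Finset.mul_sum, Finset.sum_sub_distrib, h2]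
    simp
    ring

lemma bbar_inner (γ : ℝ) (hγ0 : 0 ≤ γ) (hγ1 : γ ≤ 1) (v : E3) :
    ∑ i, bbar γ v i * v i = - Tf γ v := by
  rw [Tf_eq γ hγ0 hγ1]
  unfold bbar
  simp_rw [← integral_mul_const]
  have hi : ∀ i, Integrable fun w : E3 => bvec γ (v - w) i * gauss w * v i := by
    intro i
    have hc := rpow_cont γ hγ0
    refine (integrable_growth (F := fun z => bvec γ z i) ?_ 2 2 (fun z => ?_) v).mul_const _
    · apply Continuous.measurable; unfold bvec; fun_prop
    · unfold bvec
      have h1 := rpow_bound γ hγ0 hγ1 z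
      have h2 := coord_le z i
      have h0 := norm_nonneg z
      rw [abs_mul, abs_mul, abs_of_nonneg (by positivity : 0 ≤ ‖z‖ ^ γ)]
      norm_num
      calc 2 * ‖z‖ ^ γ * |z i| ≤ 2 * (1 + ‖z‖) * (1 + ‖z‖) := by gcongr; linarith
        _ = _ := by ring
  rw [← integral_finsetSum _ fun i _ => hi i, ← integral_const_mul, ← integral_neg]
  congr 1; funext w
  simp only [inner_coord, bvec, Fin.sum_univ_three]
  ring

lemma ell1_eq (γ : ℝ) (hγ0 : 0 ≤ γ) (v : E3) : ell1 γ v * ‖v‖ ^ 2 = Tf γ v := by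
  have s1 : Tf γ v = ∫ z : E3, (∑ j, fcoef γ v j z * v j) * gauss (v - z) := by
    unfold Tf
    rw [← integral_sub_left_eq_self (fun w : E3 => (∑ j, fcoef γ v j (v - w) * v j) * gauss w)
      volume v]
    simp
  rw [s1]
  unfold ell1
  rw [← integral_mul_const]
  congr 1; funext z
  have hv2 : ‖v‖ ^ 2 = ∑ i, v i * v i := by rw [← inner_coord, real_inner_self_eq_norm_sq]
  have e1 : ∑ j, fcoef γ v j z * v j = ‖z‖ ^ γ * (‖z‖ ^ 2 * ‖v‖ ^ 2 - (inner ℝ v z) ^ 2) := by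
    rw [hv2]
    simp only [fcoef, qf, inner_coord, Fin.sum_univ_three]
    ring
  have e2 : ∑ i, (v i / ‖v‖) * (z i / ‖z‖) = inner ℝ v z / (‖v‖ * ‖z‖) := by
    rw [inner_coord, Finset.sum_div]
    exact Finset.sum_congr rfl fun i _ => by rw [div_mul_div_comm]
  rw [e1, e2]
  by_cases hv : v = 0
  · subst hv; simp
  by_cases hz : z = 0
  · subst hz; simp [Real.zero_rpow (by linarith : γ + 2 ≠ 0)]
  have hn : 0 < ‖z‖ := norm_pos_iff.2 hz
  have hm : 0 < ‖v‖ := norm_pos_iff.2 hv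
  rw [Real.rpow_add hn, Real.rpow_two]
  field_simp

/-! ### Derivatives of the weight -/

lemma jap_pos (v : E3) : 0 < jap v := by unfold jap; positivity

lemma jap_rpow (v : E3) (s : ℝ) : jap v ^ s = (1 + ‖v‖ ^ 2) ^ (s / 2) := by
  unfold jap
  rw [Real.sqrt_eq_rpow, ← Real.rpow_mul (by positivity)]
  congr 1; ring

lemma jap_hasFDerivAt (s : ℝ) (v : E3) :
    HasFDerivAt (fun v => jap v ^ s) ((s * jap v ^ (s - 2)) • innerSL ℝ v) v := by
  simp_rw [jap_rpow]
  have h := ((normsq_hasFDerivAt v).const_add 1).rpow_const (p := s / 2) (Or.inl (by positivity))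
  refine h.congr_fderiv ?_
  rw [smul_smul]
  congr 1
  rw [show (s - 2) / 2 = s / 2 - 1 by ring]
  ring

lemma pd_jap (k : ℝ) (j : Fin 3) :
    pd j (fun v => jap v ^ k) = fun v => (k * jap v ^ (k - 2)) * v j := by
  funext v
  unfold pd
  rw [(jap_hasFDerivAt k v).fderiv]
  simp [single_inner]

lemma pd_pd_jap (k : ℝ) (i j : Fin 3) (v : E3) :
    pd i (pd j (fun v => jap v ^ k)) v =
      k * jap v ^ (k - 2) * (if i = j then 1 else 0) + k * (k - 2) * jap v ^ (k - 4) * (v i * v j)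
      := by
  rw [pd_jap]
  unfold pd
  have h3 : HasFDerivAt (fun z : E3 => z j) (EuclideanSpace.proj j : E3 →L[ℝ] ℝ) v :=
    (EuclideanSpace.proj j : E3 →L[ℝ] ℝ).hasFDerivAt
  have h := ((jap_hasFDerivAt (k - 2) v).const_mul k).mul h3
  have hs : (EuclideanSpace.single i (1 : ℝ) : E3) j = if i = j then 1 else 0 := by
    simp [Pi.single_apply, eq_comm]
  have hpj : (EuclideanSpace.proj j : E3 →L[ℝ] ℝ) (EuclideanSpace.single i 1) =
      if i = j then 1 else 0 := hs
  have h' := h.fderiv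
  simp only [Pi.mul_def] at h'
  rw [h']
  rw [show k - 4 = k - 2 - 2 by ring]
  simp only [add_apply, smul_apply, innerSL_apply_apply, single_inner, smul_eq_mul,
    hpj]
  ring

lemma phi_formula (γ : ℝ) (hγ0 : 0 ≤ γ) (hγ1 : γ ≤ 1) (k θ : ℝ) (v : E3) :
    phiW γ 1 θ (fun v => jap v ^ k) v =
      2 * k * Jfun (γ + 2) v * jap v ^ (-(2 : ℝ)) +
        k * (k - 2) * Tf γ v * jap v ^ (-(4 : ℝ)) -
        2 * k * Tf γ v * jap v ^ (-(2 : ℝ)) := by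
  have hp := jap_pos v
  have hd1 : delta1 1 θ = 1 := by simp [delta1]
  have hd2 : delta2 1 θ = 0 := by simp [delta2, delta1]
  have hk0 : jap v ^ k ≠ 0 := (Real.rpow_pos_of_pos hp k).ne'
  have r2 : jap v ^ (k - 2) = jap v ^ k * jap v ^ (-(2 : ℝ)) := by
    rw [← Real.rpow_add hp]; rfl
  have r4 : jap v ^ (k - 4) = jap v ^ k * jap v ^ (-(4 : ℝ)) := by
    rw [← Real.rpow_add hp]; rfl
  unfold phiW
  rw [hd1, hd2]
  simp only [pd_pd_jap]
  simp only [pd_jap]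
  rw [r2, r4]
  have e1 : ∀ i j : Fin 3, abar γ v i j *
      (k * (jap v ^ k * jap v ^ (-(2 : ℝ))) * (if i = j then 1 else 0) +
        k * (k - 2) * (jap v ^ k * jap v ^ (-(4 : ℝ))) * (v i * v j)) / jap v ^ k =
      (k * jap v ^ (-(2 : ℝ))) * (abar γ v i j * (if i = j then 1 else 0)) +
        (k * (k - 2) * jap v ^ (-(4 : ℝ))) * (abar γ v i j * (v i * v j)) := by
    intro i j
    rw [div_eq_iff hk0]; ring
  have e2 : ∀ i : Fin 3, bbar γ v i * (k * (jap v ^ k * jap v ^ (-(2 : ℝ))) * v i) / jap v ^ k =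
      (k * jap v ^ (-(2 : ℝ))) * (bbar γ v i * v i) := by
    intro i
    rw [div_eq_iff hk0]; ring
  have tr : ∑ i, ∑ j, abar γ v i j * (if i = j then 1 else 0) = 2 * Jfun (γ + 2) v := by
    rw [← abar_trace γ hγ0 hγ1]; simp
  simp only [e1, e2, Finset.sum_add_distrib, ← Finset.mul_sum]
  rw [abar_quad γ hγ0 hγ1, bbar_inner γ hγ0 hγ1, tr]
  ring

/-! ### The limit -/

lemma jap_atTop : Tendsto jap (comap (fun v : E3 => ‖v‖) atTop) atTop := by
  refine tendsto_atTop_mono (fun v => ?_) tendsto_comap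
  exact Real.le_sqrt_of_sq_le (by linarith)

lemma norm_le_jap (v : E3) : ‖v‖ ≤ jap v := Real.le_sqrt_of_sq_le (by linarith)

lemma one_le_jap (v : E3) : 1 ≤ jap v := Real.le_sqrt_of_sq_le (by nlinarith [norm_nonneg v])

lemma jap_sq (v : E3) : jap v ^ 2 = 1 + ‖v‖ ^ 2 := Real.sq_sqrt (by positivity)

lemma inner_ratio (w : E3) : Tendsto (fun v : E3 => inner ℝ v w / jap v ^ 2)
    (comap (fun v : E3 => ‖v‖) atTop) (nhds 0) := by
  have h1 : Tendsto (fun v : E3 => ‖w‖ / jap v) (comap (fun v : E3 => ‖v‖) atTop) (nhds 0) :=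
    jap_atTop.const_div_atTop _
  refine squeeze_zero_norm (fun v => ?_) h1
  have hp := jap_pos v
  rw [Real.norm_eq_abs, abs_div, abs_of_pos (by positivity : 0 < jap v ^ 2),
    div_le_div_iff₀ (by positivity) hp]
  calc |inner ℝ v w| * jap v ≤ (‖v‖ * ‖w‖) * jap v := by
        gcongr; exact abs_real_inner_le_norm v w
    _ ≤ (jap v * ‖w‖) * jap v := by gcongr; exact norm_le_jap v
    _ = _ := by ring

lemma jap_inv_sq : Tendsto (fun v : E3 => (jap v ^ 2)⁻¹)
    (comap (fun v : E3 => ‖v‖) atTop) (nhds 0) :=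
  (tendsto_pow_atTop two_ne_zero |>.comp jap_atTop).inv_tendsto_atTop

lemma ratio_inner (w : E3) : Tendsto (fun v : E3 => inner ℝ v (v - w) / jap v ^ 2)
    (comap (fun v : E3 => ‖v‖) atTop) (nhds 1) := by
  have h := ((tendsto_const_nhds (x := (1 : ℝ))).sub jap_inv_sq).sub (inner_ratio w)
  simp only [sub_zero] at h
  refine h.congr fun v => ?_
  have hp := jap_pos v
  have := jap_sq v
  rw [inner_sub_right, real_inner_self_eq_norm_sq]
  field_simp
  linarith

lemma ratio_norm (w : E3) : Tendsto (fun v : E3 => ‖v - w‖ / jap v)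
    (comap (fun v : E3 => ‖v‖) atTop) (nhds 1) := by
  have h := (((ratio_inner w).sub (inner_ratio w)).add (jap_inv_sq.const_mul (‖w‖ ^ 2))).sqrt
  simp only [sub_zero, mul_zero, add_zero, Real.sqrt_one] at h
  refine h.congr fun v => ?_
  have hp := jap_pos v
  rw [← Real.sqrt_sq (by positivity : 0 ≤ ‖v - w‖ / jap v)]
  congr 1
  rw [div_pow, norm_sub_sq_real, inner_sub_right, real_inner_self_eq_norm_sq]
  field_simp
  ring

lemma ratio_le (v w : E3) : ‖v - w‖ / jap v ≤ 1 + ‖w‖ := by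
  have hp := jap_pos v
  rw [div_le_iff₀ hp]
  have := norm_sub_le v w
  have := norm_le_jap v
  have := one_le_jap v
  nlinarith [norm_nonneg w]

lemma rpow_ratio (γ : ℝ) (v z : E3) :
    ‖z‖ ^ γ * jap v ^ (-γ) = (‖z‖ / jap v) ^ γ := by
  rw [Real.div_rpow (norm_nonneg _) (jap_pos v).le, Real.rpow_neg (jap_pos v).le, div_eq_mul_inv]

lemma ratio_rpow_le (γ : ℝ) (hγ0 : 0 ≤ γ) (hγ1 : γ ≤ 1) (v w : E3) :
    (‖v - w‖ / jap v) ^ γ ≤ 1 + ‖w‖ := by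
  have hp := jap_pos v
  calc (‖v - w‖ / jap v) ^ γ ≤ (1 + ‖w‖) ^ γ := by gcongr; exact ratio_le v w
    _ ≤ (1 + ‖w‖) ^ (1 : ℝ) := Real.rpow_le_rpow_of_exponent_le (by linarith [norm_nonneg w]) hγ1
    _ = _ := Real.rpow_one _

/-- A common dominated convergence argument. -/
lemma dct (γ : ℝ) (hγ0 : 0 ≤ γ) (hγ1 : γ ≤ 1) (Q : E3 → E3 → ℝ)
    (hQc : ∀ v, Continuous (Q v)) (hQb : ∀ v w, |Q v w| ≤ (1 + ‖w‖) ^ 2)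
    (hQ : ∀ w, Tendsto (fun v => Q v w) (comap (fun v : E3 => ‖v‖) atTop) (nhds 1)) :
    Tendsto (fun v : E3 => ∫ w : E3, (‖v - w‖ / jap v) ^ γ * Q v w * gauss w)
      (comap (fun v : E3 => ‖v‖) atTop) (nhds 1) := by
  rw [← integral_gauss]
  refine tendsto_integral_filter_of_dominated_convergence
    (fun w => (1 + ‖w‖) ^ 3 * gauss w) ?_ ?_ (integrable_poly_gauss 3) ?_
  · refine Eventually.of_forall fun v => ?_
    have h1 : Continuous fun w : E3 => (‖v - w‖ / jap v) ^ γ :=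
      Continuous.rpow_const (by fun_prop) fun _ => Or.inr hγ0
    exact ((h1.mul (hQc v)).mul gauss_cont).aestronglyMeasurable
  · refine Eventually.of_forall fun v => ae_of_all _ fun w => ?_
    have hp := jap_pos v
    rw [norm_mul, norm_mul, Real.norm_of_nonneg (gauss_nonneg w),
      Real.norm_of_nonneg (by positivity), Real.norm_eq_abs]
    have h1 := ratio_rpow_le γ hγ0 hγ1 v w
    have h2 := hQb v w
    gcongr
    · exact gauss_nonneg w
    calc _ ≤ (1 + ‖w‖) * (1 + ‖w‖) ^ 2 := by gcongr
      _ = _ := by ring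
  · refine ae_of_all _ fun w => ?_
    have h1 := (ratio_norm w).rpow_const (p := γ) (Or.inl one_ne_zero)
    have h := (h1.mul (hQ w)).mul_const (gauss w)
    simpa using h

lemma J_lim (γ : ℝ) (hγ0 : 0 ≤ γ) (hγ1 : γ ≤ 1) :
    Tendsto (fun v : E3 => Jfun (γ + 2) v * (jap v ^ (-(2 : ℝ)) * jap v ^ (-γ)))
      (comap (fun v : E3 => ‖v‖) atTop) (nhds 1) := by
  have h := dct γ hγ0 hγ1 (fun v w => (‖v - w‖ / jap v) ^ 2) (fun v => by fun_prop)
    (fun v w => by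
      have hp := jap_pos v
      rw [abs_of_nonneg (by positivity)]
      gcongr
      exact ratio_le v w)
    (fun w => by simpa using (ratio_norm w).pow 2)
  refine h.congr fun v => ?_
  have hp := jap_pos v
  unfold Jfun
  rw [← integral_mul_const]
  congr 1; funext w
  rw [← rpow_ratio, Real.rpow_neg hp.le 2, Real.rpow_two, div_pow,
    Real.rpow_add_of_nonneg (norm_nonneg _) hγ0 (by norm_num), Real.rpow_two]
  field_simp

lemma T_lim (γ : ℝ) (hγ0 : 0 ≤ γ) (hγ1 : γ ≤ 1) :
    Tendsto (fun v : E3 => Tf γ v * (jap v ^ (-(2 : ℝ)) * jap v ^ (-γ)))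
      (comap (fun v : E3 => ‖v‖) atTop) (nhds 2) := by
  have h := dct γ hγ0 hγ1 (fun v w => inner ℝ v (v - w) / jap v ^ 2) (fun v => by fun_prop)
    (fun v w => by
      have hp := jap_pos v
      rw [abs_div, abs_of_pos (by positivity : 0 < jap v ^ 2)]
      have h1 := abs_real_inner_le_norm v (v - w)
      have h2 := ratio_le v w
      rw [div_le_iff₀ hp] at h2
      rw [div_le_iff₀ (by positivity)]
      have h3 := norm_le_jap v
      calc _ ≤ _ := h1
        _ ≤ jap v * ((1 + ‖w‖) * jap v) := by gcongr
        _ = (1 + ‖w‖) * jap v ^ 2 := by ring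
        _ ≤ (1 + ‖w‖) ^ 2 * jap v ^ 2 := by
          gcongr
          nlinarith [norm_nonneg w])
    (fun w => ratio_inner w)
  have h' := h.const_mul 2
  rw [mul_one] at h'
  refine h'.congr fun v => ?_
  have hp := jap_pos v
  rw [Tf_eq γ hγ0 hγ1, mul_assoc, ← integral_mul_const]
  congr 2; funext w
  rw [← rpow_ratio, Real.rpow_neg hp.le 2, Real.rpow_two]
  field_simp

lemma comap_norm_neBot : (comap (fun v : E3 => ‖v‖) atTop).NeBot := by
  rw [show comap (fun v : E3 => ‖v‖) atTop = Bornology.cobounded E3 from comap_norm_atTop]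
  infer_instance

/-- For `m = ⟨v⟩^k`, `p = 1` and any `θ`: `δ₁(1,θ) = 1`, `δ₂(1,θ) = 0`, the explicit
formula for `φ_{m,1,θ}` and `limsup_{|v|→∞} φ_{m,1,θ}(v) ⟨v⟩^{-γ} ≤ -2k`. -/
theorem stmt17 (γ : ℝ) (hγ0 : 0 ≤ γ) (hγ1 : γ ≤ 1) (k : ℝ) (hk : 0 < k) (θ : ℝ) :
    delta1 1 θ = 1 ∧ delta2 1 θ = 0 ∧
    (∀ v : E3, phiW γ 1 θ (fun v => jap v ^ k) v =
      2 * k * Jfun (γ + 2) v * jap v ^ (-(2 : ℝ)) +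
        k * (k - 2) * ell1 γ v * ‖v‖ ^ 2 * jap v ^ (-(4 : ℝ)) -
        2 * k * ell1 γ v * ‖v‖ ^ 2 * jap v ^ (-(2 : ℝ))) ∧
    limsup (fun v : E3 => phiW γ 1 θ (fun v => jap v ^ k) v * jap v ^ (-γ))
        (comap (fun v : E3 => ‖v‖) atTop) ≤ -2 * k := by
  refine ⟨by simp [delta1], by simp [delta2, delta1], fun v => ?_, ?_⟩
  · rw [phi_formula γ hγ0 hγ1, ← ell1_eq γ hγ0]
    ring
  · haveI := comap_norm_neBot
    refine le_of_eq (Tendsto.limsup_eq ?_)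
    have hT := T_lim γ hγ0 hγ1
    have h := (((J_lim γ hγ0 hγ1).const_mul (2 * k)).add
      ((jap_inv_sq.mul hT).const_mul (k * (k - 2)))).sub (hT.const_mul (2 * k))
    rw [show 2 * k * 1 + k * (k - 2) * (0 * 2) - 2 * k * 2 = -2 * k by ring] at h
    refine h.congr fun v => ?_
    have hp := jap_pos v
    rw [phi_formula γ hγ0 hγ1]
    have r4 : jap v ^ (-(4 : ℝ)) = (jap v ^ 2)⁻¹ * jap v ^ (-(2 : ℝ)) := by
      rw [← Real.rpow_two, ← Real.rpow_neg hp.le, ← Real.rpow_add hp]; norm_num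
    rw [r4]
    ring
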